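/- Let n, k : ℕ with k ≤ n. The hypersimplex Δ_{n,k}, defined as the convex hull in (Fin n → ℝ) of the vectors {Λ_I : I ⊆ Fin n, #I = k}, equals the intersection of the unit cube with a hyperplane: convexHull ℝ {Λ_I : #I = k} = {x : Fin n → ℝ | (∀ i, 0 ≤ x i ∧ x i ≤ 1) ∧ ∑ i, x i = k}. -/

import Mathlib

/-- The 0/1 indicator vector `Λ_I ∈ ℝⁿ` of a subset `I ⊆ Fin n`. -/
def lambdaVec {n : ℕ} (I : Finset (Fin n)) : Fin n → ℝ :=
  fun i => if i ∈ I then 1 else 0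

theorem hs_step {n : ℕ} (x : Fin n → ℝ) (hx : ∀ i, 0 ≤ x i ∧ x i ≤ 1) (i j : Fin n) (hij : i ≠ j)
    (hi : 0 < x i ∧ x i < 1) (hj : 0 < x j ∧ x j < 1) :
    ∃ d : ℝ, 0 < d ∧ (∀ l, 0 ≤ (x + d • (Pi.single i 1 - Pi.single j 1 : Fin n → ℝ)) l ∧
      (x + d • (Pi.single i 1 - Pi.single j 1 : Fin n → ℝ)) l ≤ 1) ∧
      ∑ l, (x + d • (Pi.single i 1 - Pi.single j 1 : Fin n → ℝ)) l = ∑ l, x l ∧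
      {l | 0 < (x + d • (Pi.single i 1 - Pi.single j 1 : Fin n → ℝ)) l ∧
        (x + d • (Pi.single i 1 - Pi.single j 1 : Fin n → ℝ)) l < 1}.ncard
        < {l | 0 < x l ∧ x l < 1}.ncard := by
  obtain ⟨d, hd0, hd1, hd2, hd3⟩ : ∃ d : ℝ, 0 < d ∧ d ≤ 1 - x i ∧ d ≤ x j ∧
      (d = 1 - x i ∨ d = x j) := by
    rcases le_total (1 - x i) (x j) with h | h
    · exact ⟨1 - x i, by linarith, le_rfl, h, Or.inl rfl⟩
    · exact ⟨x j, hj.1, h, le_rfl, Or.inr rfl⟩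
  have ei : (x + d • (Pi.single i 1 - Pi.single j 1 : Fin n → ℝ)) i = x i + d := by
    simp [hij]
  have ej : (x + d • (Pi.single i 1 - Pi.single j 1 : Fin n → ℝ)) j = x j - d := by
    simp [hij.symm]; ring
  have el : ∀ l, l ≠ i → l ≠ j →
      (x + d • (Pi.single i 1 - Pi.single j 1 : Fin n → ℝ)) l = x l := by
    intro l h1 h2
    simp [h1, h2]
  have es : ∑ l, (x + d • (Pi.single i 1 - Pi.single j 1 : Fin n → ℝ)) l = ∑ l, x l := by
    simp [Finset.sum_add_distrib, ← Finset.mul_sum]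
  refine ⟨d, hd0, ?_, es, ?_⟩
  · intro l
    by_cases h1 : l = i
    · subst h1; rw [ei]; constructor <;> linarith
    by_cases h2 : l = j
    · subst h2; rw [ej]; constructor <;> linarith
    rw [el l h1 h2]; exact hx l
  · generalize (x + d • (Pi.single i 1 - Pi.single j 1 : Fin n → ℝ)) = y at *
    apply Set.ncard_lt_ncard _ (Set.toFinite _)
    rw [Set.ssubset_iff_of_subset]
    · rcases hd3 with h | h
      · refine ⟨i, hi, ?_⟩
        rintro ⟨_, h'⟩
        linarith
      · refine ⟨j, hj, ?_⟩
        rintro ⟨h', _⟩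
        linarith
    · intro l hl
      by_cases h1 : l = i
      · subst h1; exact hi
      by_cases h2 : l = j
      · subst h2; exact hj
      have := el l h1 h2
      simp only [Set.mem_ofPred_eq] at hl ⊢
      rwa [this] at hl

theorem hs_mem {n : ℕ} (k N : ℕ) : ∀ x : Fin n → ℝ, (∀ i, 0 ≤ x i ∧ x i ≤ 1) →
    ∑ i, x i = (k : ℝ) → {l | 0 < x l ∧ x l < 1}.ncard = N →
    x ∈ convexHull ℝ {x : Fin n → ℝ | ∃ I : Finset (Fin n), I.card = k ∧ x = lambdaVec I} := by
  induction N using Nat.strong_induction_on with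
  | _ N ih =>
  intro x hx hs hN
  by_cases hf : ∃ i, 0 < x i ∧ x i < 1
  · obtain ⟨i, hi⟩ := hf
    by_cases hg : ∃ j, i ≠ j ∧ 0 < x j ∧ x j < 1
    · obtain ⟨j, hij, hj⟩ := hg
      obtain ⟨d, hd, h1, h2, h3⟩ := hs_step x hx i j hij hi hj
      obtain ⟨e, he, g1, g2, g3⟩ := hs_step x hx j i hij.symm hj hi
      have A := ih _ (hN ▸ h3) _ h1 (h2.trans hs) rfl
      have B := ih _ (hN ▸ g3) _ g1 (g2.trans hs) rfl
      have hde : d + e ≠ 0 := by positivity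
      have C := (convex_convexHull ℝ {x : Fin n → ℝ | ∃ I : Finset (Fin n), I.card = k ∧
        x = lambdaVec I}) A B (a := e / (d + e)) (b := d / (d + e)) (by positivity)
        (by positivity) (by field_simp; ring)
      convert C using 1
      ext l
      simp only [Pi.add_apply, Pi.smul_apply, Pi.sub_apply, smul_eq_mul]
      field_simp
      ring
    · exfalso
      push Not at hg
      have h01 : ∀ l ∈ Finset.univ.erase i, x l = if x l = 1 then 1 else 0 := by
        intro l hl
        have hl' : i ≠ l := (Finset.ne_of_mem_erase hl).symm
        split_ifs with h
        · exact h
        · by_contra h0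
          have := hg l hl' (lt_of_le_of_ne (hx l).1 (Ne.symm h0))
          exact h (le_antisymm (hx l).2 this)
      rw [← Finset.add_sum_erase _ _ (Finset.mem_univ i), Finset.sum_congr rfl h01,
        Finset.sum_boole] at hs
      generalize (Finset.card _) = m at hs
      have a1 : (m : ℝ) < k := by linarith [hi.1]
      have a2 : (k : ℝ) < m + 1 := by linarith [hi.2]
      have a1' : m < k := by exact_mod_cast a1
      have a2' : k < m + 1 := by exact_mod_cast a2
      omega
  · push Not at hf
    have h01 : ∀ l, x l = if x l = 1 then 1 else 0 := by
      intro l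
      split_ifs with h
      · exact h
      · by_contra h0
        have := hf l (lt_of_le_of_ne (hx l).1 (Ne.symm h0))
        exact h (le_antisymm (hx l).2 this)
    apply subset_convexHull
    refine ⟨Finset.univ.filter (fun l => x l = 1), ?_, ?_⟩
    · rw [Finset.sum_congr rfl (fun l _ => h01 l), Finset.sum_boole] at hs
      exact_mod_cast hs
    · ext l
      rw [h01 l]
      simp [lambdaVec]

/-- The hypersimplex `Δ_{n,k}`, the convex hull of the indicator vectors `Λ_I` of `k`-element
subsets of `Fin n`, equals the intersection of the unit cube with the hyperplane `∑ xᵢ = k`. -/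
theorem hypersimplex_eq_cube_cap_hyperplane (n k : ℕ) (hk : k ≤ n) :
    convexHull ℝ {x : Fin n → ℝ | ∃ I : Finset (Fin n), I.card = k ∧ x = lambdaVec I} =
      {x : Fin n → ℝ | (∀ i, 0 ≤ x i ∧ x i ≤ 1) ∧ ∑ i, x i = (k : ℝ)} := by
  apply Set.Subset.antisymm
  · apply convexHull_min
    · rintro x ⟨I, hI, rfl⟩
      refine ⟨fun i => ?_, ?_⟩
      · unfold lambdaVec; split_ifs <;> norm_num
      · simp [lambdaVec, hI]
    · intro x hx y hy a b ha hb hab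
      refine ⟨fun i => ?_, ?_⟩
      · have h1 := hx.1 i
        have h2 := hy.1 i
        simp only [Pi.add_apply, Pi.smul_apply, smul_eq_mul]
        constructor
        · have := mul_nonneg ha h1.1
          have := mul_nonneg hb h2.1
          linarith
        · have := mul_le_mul_of_nonneg_left h1.2 ha
          have := mul_le_mul_of_nonneg_left h2.2 hb
          linarith
      · simp only [Pi.add_apply, Pi.smul_apply, smul_eq_mul, Finset.sum_add_distrib,
          ← Finset.mul_sum, hx.2, hy.2]
        rw [← add_mul, hab, one_mul]
  · rintro x ⟨hx, hs⟩
    exact hs_mem k _ x hx hs rfl
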